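/- arXiv:1805.01997 — 2 statements merged into one kernel-verified Lean document; each statement's English description precedes it below -/
import Mathlib

section
/- Let n ≥ 1, let K be a subset of ℝⁿ that is locally connected in its subspace topology and nowhere flat in ℝⁿ, and let A ⊆ K be an analytic set that is non-meager in the subspace K. Then the n-fold Minkowski sum A^{+n} is a non-meager analytic subset of ℝⁿ. -/
/-- The `n`-fold Minkowski sum `T + ⋯ + T` of a set `T`. -/
def nFoldSum {X : Type*} [AddCommMonoid X] (T : Set X) (n : ℕ) : Set X :=
  {x | ∃ f : Fin n → X, (∀ i, f i ∈ T) ∧ ∑ i, f i = x}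

/-- A set `K ⊆ ℝⁿ` is nowhere flat if every nonempty relatively open subset of `K`
has affine span equal to all of `ℝⁿ`. -/
def NowhereFlat {n : ℕ} (K : Set (Fin n → ℝ)) : Prop :=
  ∀ V : Set (Fin n → ℝ), IsOpen V → (V ∩ K).Nonempty → affineSpan ℝ (V ∩ K) = ⊤

open Topology Set Pointwise

theorem IsOpen.residual_forall_dense_section {X Y : Type*} [TopologicalSpace X] [TopologicalSpace Y]
    [SecondCountableTopology Y] {U : Set (X × Y)} (hU : IsOpen U) (hd : Dense U) :
    ∀ᶠ x in residual X, Dense (Prod.mk x ⁻¹' U) := by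
  have hB := TopologicalSpace.isBasis_countableBasis Y
  have : ∀ᶠ x in residual X, ∀ V ∈ TopologicalSpace.countableBasis Y,
      (V ∩ (Prod.mk x ⁻¹' U)).Nonempty := by
    rw [eventually_countable_ball (TopologicalSpace.countable_countableBasis Y)]
    intro V hV
    have hVo := hB.isOpen hV
    have hVn : V.Nonempty := TopologicalSpace.nonempty_of_mem_countableBasis hV
    have key : {x : X | (V ∩ (Prod.mk x ⁻¹' U)).Nonempty} = Prod.fst '' (U ∩ (univ ×ˢ V)) := by
      ext x
      constructor
      · rintro ⟨y, hy, hxy⟩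
        exact ⟨(x, y), ⟨hxy, trivial, hy⟩, rfl⟩
      · rintro ⟨⟨x', y⟩, ⟨hxy, -, hy⟩, rfl⟩
        exact ⟨y, hy, hxy⟩
    refine residual_of_dense_open (s := {x : X | (V ∩ (Prod.mk x ⁻¹' U)).Nonempty}) ?_ ?_
    · rw [key]
      exact isOpenMap_fst _ (hU.inter (isOpen_univ.prod hVo))
    · rw [dense_iff_inter_open]
      intro W hW hWn
      obtain ⟨⟨x, y⟩, ⟨hx, hy⟩, hxy⟩ :=
        hd.inter_open_nonempty (W ×ˢ V) (hW.prod hVo) (hWn.prod hVn)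
      exact ⟨x, hx, y, hy, hxy⟩
  filter_upwards [this] with x hx
  rw [hB.dense_iff]
  intro V hV _
  exact hx V hV

theorem IsMeagre.residual_isMeagre_section {X Y : Type*} [TopologicalSpace X] [TopologicalSpace Y]
    [SecondCountableTopology Y] {M : Set (X × Y)} (hM : IsMeagre M) :
    ∀ᶠ x in residual X, IsMeagre (Prod.mk x ⁻¹' M) := by
  obtain ⟨S, hSo, hSd, hSc, hS⟩ := mem_residual_iff.1 hM
  have : ∀ᶠ x in residual X, ∀ U ∈ S, Dense (Prod.mk x ⁻¹' U) := by
    rw [eventually_countable_ball hSc]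
    exact fun U hU ↦ (hSo U hU).residual_forall_dense_section (hSd U hU)
  filter_upwards [this] with x hx
  have : ∀ U ∈ S, Prod.mk x ⁻¹' U ∈ residual Y := fun U hU ↦
    residual_of_dense_open ((hSo U hU).preimage (by fun_prop)) (hx U hU)
  refine Filter.mem_of_superset ((countable_bInter_mem hSc).2 this) ?_
  intro y hy
  exact hS (mem_sInter.2 fun U hU ↦ mem_iInter₂.1 hy U hU)

theorem not_isMeagre_prod {X Y : Type*} [TopologicalSpace X] [TopologicalSpace Y]
    [SecondCountableTopology Y] {A : Set X} {B : Set Y} (hA : ¬ IsMeagre A) (hB : ¬ IsMeagre B) :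
    ¬ IsMeagre (A ×ˢ B) := by
  intro h
  refine hA (Filter.mem_of_superset h.residual_isMeagre_section ?_)
  intro x hx hxA
  have hsub : B ⊆ Prod.mk x ⁻¹' (A ×ˢ B) := fun y hy ↦ ⟨hxA, hy⟩
  exact hB (hx.mono hsub)

theorem not_isMeagre_pi_fin {X : Type*} [TopologicalSpace X] [SecondCountableTopology X]
    {A : Set X} (hA : ¬ IsMeagre A) (n : ℕ) : ¬ IsMeagre {f : Fin n → X | ∀ i, f i ∈ A} := by
  induction n with
  | zero => exact not_isMeagre_of_isOpen (by simp) ⟨Fin.elim0, fun i ↦ i.elim0⟩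
  | succ n ih =>
    intro h
    let e : X × (Fin n → X) ≃ₜ (Fin (n + 1) → X) :=
      { toEquiv := Fin.consEquiv (fun _ ↦ X)
        continuous_toFun := by
          change Continuous fun p : X × (Fin n → X) ↦ (Fin.cons p.1 p.2 : Fin (n + 1) → X)
          fun_prop
        continuous_invFun := by
          change Continuous fun f : Fin (n + 1) → X ↦ (f 0, Fin.tail f)
          fun_prop }
    refine not_isMeagre_prod hA ih ((h.preimage_of_isOpenMap e.continuous e.isOpenMap).mono ?_)
    rintro ⟨x, f⟩ ⟨hx, hf⟩
    change ∀ i, (Fin.cons x f : Fin (n + 1) → X) i ∈ A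
    exact Fin.cases hx hf

theorem MeasureTheory.AnalyticSet.nFoldSum {X : Type*} [AddCommMonoid X] [TopologicalSpace X]
    [ContinuousAdd X] {A : Set X} (hA : AnalyticSet A) (n : ℕ) : AnalyticSet (nFoldSum A n) := by
  obtain ⟨Z, _, _, g, hg, rfl⟩ := analyticSet_iff_exists_polishSpace_range.1 hA
  refine analyticSet_iff_exists_polishSpace_range.2
    ⟨Fin n → Z, inferInstance, inferInstance, fun z ↦ ∑ i, g (z i), by fun_prop, ?_⟩
  ext x
  constructor
  · rintro ⟨z, rfl⟩
    exact ⟨fun i ↦ g (z i), fun i ↦ mem_range_self _, rfl⟩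
  · rintro ⟨f, hf, rfl⟩
    choose z hz using hf
    exact ⟨z, by simp [hz]⟩

theorem exists_open_sum_mem_closed_of_isMeagre_nFoldSum {X Y : Type*} [TopologicalSpace X]
    [SecondCountableTopology X] [AddCommMonoid Y] [TopologicalSpace Y] [ContinuousAdd Y]
    {g : X → Y} (hg : Continuous g) {A : Set X} (hA : ¬ IsMeagre A) {n : ℕ}
    (h : IsMeagre (nFoldSum (g '' A) n)) :
    ∃ (F : Set Y) (U : Fin n → Set X), IsClosed F ∧ interior F = ∅ ∧ (∀ i, IsOpen (U i)) ∧
      (∀ i, (U i).Nonempty) ∧ ∀ f : Fin n → X, (∀ i, f i ∈ U i) → ∑ i, g (f i) ∈ F := by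
  by_contra! H
  obtain ⟨S, hS, hSc, hsub⟩ := isMeagre_iff_countable_union_isNowhereDense.1 h
  refine not_isMeagre_pi_fin hA n (isMeagre_iff_countable_union_isNowhereDense.2
    ⟨(fun F ↦ (fun f : Fin n → X ↦ ∑ i, g (f i)) ⁻¹' (closure F)) '' S, ?_, hSc.image _, ?_⟩)
  · rintro _ ⟨F, hF, rfl⟩
    have hc : Continuous fun f : Fin n → X ↦ ∑ i, g (f i) := by fun_prop
    rw [(isClosed_closure.preimage hc).isNowhereDense_iff]
    by_contra! hne
    obtain ⟨f, hf⟩ := hne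
    obtain ⟨U, hU, hUs⟩ := isOpen_pi_iff'.1 isOpen_interior f hf
    obtain ⟨f', hf', hn⟩ := H (closure F) U isClosed_closure (hS F hF) (fun i ↦ (hU i).1)
      (fun i ↦ ⟨f i, (hU i).2⟩)
    have hmem := interior_subset (hUs (show f' ∈ univ.pi U from fun i _ ↦ hf' i))
    exact hn hmem
  · intro f hf
    obtain ⟨F, hF, hx⟩ := hsub ⟨fun i ↦ g (f i), fun i ↦ mem_image_of_mem _ (hf i), rfl⟩
    exact ⟨_, mem_image_of_mem _ hF, subset_closure hx⟩

open MeasureTheory in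
theorem exists_continuousLinearMap_integral_comp {Ω T : Type*} [MeasurableSpace Ω]
    {ν : Measure Ω} [TopologicalSpace T] [CompactSpace T] [MeasurableSpace T] [BorelSpace T]
    {h : Ω → T} (hh : Measurable h) {w : Ω → ℂ} (hw : Integrable w ν) :
    ∃ L : C(T, ℂ) →L[ℂ] ℂ, ∀ g, L g = ∫ ω, g (h ω) * w ω ∂ν := by
  have hI (g : C(T, ℂ)) : Integrable (fun ω ↦ g (h ω) * w ω) ν :=
    hw.bdd_mul (c := ‖g‖) (g.continuous.measurable.comp hh).aestronglyMeasurable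
      (.of_forall fun ω ↦ g.norm_coe_le_norm _)
  let L : C(T, ℂ) →ₗ[ℂ] ℂ :=
    { toFun := fun g ↦ ∫ ω, g (h ω) * w ω ∂ν
      map_add' := fun f g ↦ by
        simp only [ContinuousMap.add_apply, add_mul]
        exact integral_add (hI f) (hI g)
      map_smul' := fun c g ↦ by
        simp only [ContinuousMap.smul_apply, smul_eq_mul, mul_assoc, RingHom.id_apply]
        exact integral_const_mul _ _ }
  refine ⟨L.mkContinuous (∫ ω, ‖w ω‖ ∂ν) fun g ↦ ?_, fun g ↦ rfl⟩
  change ‖∫ ω, g (h ω) * w ω ∂ν‖ ≤ _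
  rw [mul_comm, ← integral_const_mul]
  refine (norm_integral_le_integral_norm _).trans (integral_mono (hI g).norm
    (hw.norm.const_mul _) fun ω ↦ ?_)
  simp only [norm_mul]
  gcongr
  exact g.norm_coe_le_norm _

/-- The quotient map `ℝⁿ → ℝⁿ / ℤⁿ`. -/
def UnitAddTorus.mkHom (n : ℕ) : (Fin n → ℝ) →+ UnitAddTorus (Fin n) where
  toFun x := fun j ↦ (x j : UnitAddCircle)
  map_zero' := by ext j; simp
  map_add' x y := by ext j; simp

theorem UnitAddTorus.continuous_mkHom (n : ℕ) : Continuous (mkHom n) :=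
  continuous_pi fun j ↦ (AddCircle.continuous_mk' (1 : ℝ)).comp (continuous_apply j)

theorem UnitAddTorus.mFourier_add_apply {d : Type*} [Fintype d] (m : d → ℤ) (x y : UnitAddTorus d) :
    mFourier m (x + y) = mFourier m x * mFourier m y := by
  simp [mFourier, fourier_apply, AddCircle.toCircle_add, Finset.prod_mul_distrib]

theorem UnitAddTorus.mFourier_apply_zero {d : Type*} [Fintype d] (m : d → ℤ) :
    mFourier m (0 : UnitAddTorus d) = 1 := by
  simp [mFourier]

theorem UnitAddTorus.mFourier_sum_apply {d ι : Type*} [Fintype d] (m : d → ℤ) (s : Finset ι)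
    (x : ι → UnitAddTorus d) :
    mFourier m (∑ i ∈ s, x i) = ∏ i ∈ s, mFourier m (x i) := by
  induction s using Finset.cons_induction with
  | empty => simp [mFourier_apply_zero]
  | cons a s ha ih => rw [Finset.sum_cons, Finset.prod_cons, mFourier_add_apply, ih]

theorem UnitAddTorus.mFourier_mkHom {n : ℕ} (m : Fin n → ℤ) (x : Fin n → ℝ) :
    mFourier m (mkHom n x) = Complex.exp (2 * Real.pi * Complex.I * ∑ j, m j * (x j : ℂ)) := by
  simp only [mFourier, mkHom, AddMonoidHom.coe_mk, ZeroHom.coe_mk, ContinuousMap.coe_mk,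
    fourier_coe_apply, ← Complex.exp_sum, Finset.mul_sum]
  congr 1
  refine Finset.sum_congr rfl fun j _ ↦ ?_
  push_cast
  ring

open MeasureTheory in
theorem UnitAddTorus.integral_mFourier {d : Type*} [Fintype d] {m : d → ℤ} (hm : m ≠ 0) :
    ∫ x, mFourier m x ∂(Measure.pi fun _ : d ↦ AddCircle.haarAddCircle (T := 1)) = 0 := by
  obtain ⟨j, hj⟩ := Function.ne_iff.1 hm
  change ∫ x : d → UnitAddCircle, ∏ i, fourier (m i) (x i) ∂_ = 0
  rw [integral_fintype_prod_eq_prod (𝕜 := ℂ)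
    (fun i (x : UnitAddCircle) ↦ (fourier (m i) x : ℂ))]
  refine Finset.prod_eq_zero (Finset.mem_univ j) ?_
  exact integral_eq_zero_of_add_right_eq_neg (fourier_add_half_inv_index hj one_pos)

open MeasureTheory UnitAddTorus in
theorem integral_mFourier_path {n : ℕ} {γ γ' : ℝ → Fin n → ℝ}
    (hγ : ∀ t, HasDerivAt γ (γ' t) t) (hγ' : Continuous γ') (m : Fin n → ℤ)
    (hm : mkHom n (γ 1) = mkHom n (γ 0)) :
    ∑ j, (∫ t in Ioc (0 : ℝ) 1, mFourier m (mkHom n (γ t)) * γ' t j) * m j = 0 := by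
  have hγc : Continuous γ := continuous_iff_continuousAt.2 fun t ↦ (hγ t).continuousAt
  have hc := (mFourier m).continuous.comp ((continuous_mkHom n).comp hγc)
  have hI (j : Fin n) : IntervalIntegrable
      (fun t ↦ mFourier m (mkHom n (γ t)) * (γ' t j : ℂ) * m j) volume 0 1 := by
    refine Continuous.intervalIntegrable ?_ _ _
    have : Continuous fun t ↦ mFourier m (mkHom n (γ t)) := hc
    fun_prop
  have key : ∫ t in (0 : ℝ)..1, ∑ j, mFourier m (mkHom n (γ t)) * (γ' t j : ℂ) * m j = 0 := by
    have hd (t : ℝ) : HasDerivAt (fun t ↦ mFourier m (mkHom n (γ t)) / (2 * Real.pi * Complex.I))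
        (∑ j, mFourier m (mkHom n (γ t)) * (γ' t j : ℂ) * m j) t := by
      simp only [mFourier_mkHom]
      have h1 : HasDerivAt (fun t ↦ 2 * Real.pi * Complex.I * ∑ j, m j * (γ t j : ℂ))
          (2 * Real.pi * Complex.I * ∑ j, m j * (γ' t j : ℂ)) t := by
        refine HasDerivAt.const_mul _ (HasDerivAt.fun_sum fun j _ ↦ HasDerivAt.const_mul _ ?_)
        exact ((hasDerivAt_pi.1 (hγ t)) j).ofReal_comp
      convert! h1.cexp.div_const (2 * Real.pi * Complex.I) using 1
      have : (2 * Real.pi * Complex.I : ℂ) ≠ 0 := Complex.two_pi_I_ne_zero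
      rw [eq_div_iff this]
      generalize Complex.exp _ = E
      simp only [Finset.mul_sum, Finset.sum_mul]
      exact Finset.sum_congr rfl fun j _ ↦ by ring
    rw [intervalIntegral.integral_eq_sub_of_hasDerivAt (fun t _ ↦ hd t)
      (by simpa only [Finset.sum_fn] using IntervalIntegrable.sum Finset.univ fun j _ ↦ hI j),
      hm, sub_self]
  rw [intervalIntegral.integral_finsetSum fun j _ ↦ hI j] at key
  rw [← key]
  refine Finset.sum_congr rfl fun j _ ↦ ?_
  rw [intervalIntegral.integral_mul_const, intervalIntegral.integral_of_le zero_le_one]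


open MeasureTheory UnitAddTorus in
theorem integral_mFourier_mul_det {n : ℕ} {γ γ' : Fin n → ℝ → Fin n → ℝ}
    (hγ : ∀ i t, HasDerivAt (γ i) (γ' i t) t) (hγ' : ∀ i, Continuous (γ' i)) (m : Fin n → ℤ) :
    ∫ t : Fin n → ℝ, mFourier m (mkHom n (∑ i, γ i (t i))) *
        (Matrix.of fun i j ↦ (γ' i (t i) j : ℂ)).det
          ∂(Measure.pi fun _ ↦ volume.restrict (Ioc (0 : ℝ) 1)) =
      (Matrix.of fun i j ↦ ∫ t in Ioc (0 : ℝ) 1, mFourier m (mkHom n (γ i t)) * γ' i t j).det := by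
  have hγc (i) : Continuous (γ i) := continuous_iff_continuousAt.2 fun t ↦ (hγ i t).continuousAt
  have hc (i) : Continuous fun t ↦ mFourier m (mkHom n (γ i t)) :=
    (mFourier m).continuous.comp ((continuous_mkHom n).comp (hγc i))
  have hI (i j : Fin n) : Integrable (fun t ↦ mFourier m (mkHom n (γ i t)) * (γ' i t j : ℂ))
      (volume.restrict (Ioc (0 : ℝ) 1)) := by
    have : Continuous (fun t ↦ mFourier m (mkHom n (γ i t)) * (γ' i t j : ℂ)) := by fun_prop
    exact (this.integrableOn_Icc (a := 0) (b := 1)).mono_set Ioc_subset_Icc_self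
  rw [← Matrix.det_transpose, Matrix.det_apply']
  simp only [map_sum, mFourier_sum_apply, Matrix.transpose_apply, Matrix.of_apply]
  simp only [← Matrix.det_transpose (Matrix.of fun i j ↦ (γ' i _ j : ℂ)), Matrix.det_apply',
    Matrix.transpose_apply, Matrix.of_apply, Finset.mul_sum]
  have hprod (σ : Equiv.Perm (Fin n)) (t : Fin n → ℝ) :
      (∏ i, mFourier m (mkHom n (γ i (t i)))) *
        (((Equiv.Perm.sign σ : ℤ) : ℂ) * ∏ i, (γ' i (t i) (σ i) : ℂ)) =
      ((Equiv.Perm.sign σ : ℤ) : ℂ) *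
        ∏ i, (mFourier m (mkHom n (γ i (t i))) * (γ' i (t i) (σ i) : ℂ)) := by
    rw [Finset.prod_mul_distrib]; ring
  simp only [hprod]
  rw [integral_finsetSum]
  · refine Finset.sum_congr rfl fun σ _ ↦ ?_
    rw [integral_const_mul, integral_fintype_prod_eq_prod (𝕜 := ℂ)
      (fun i (t : ℝ) ↦ mFourier m (mkHom n (γ i t)) * (γ' i t (σ i) : ℂ))]
  · intro σ _
    exact (Integrable.fintype_prod (f := fun i (t : ℝ) ↦
      mFourier m (mkHom n (γ i t)) * (γ' i t (σ i) : ℂ)) fun i ↦ hI i (σ i)).const_mul _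

open MeasureTheory UnitAddTorus in
/-- The sum map of `n` smooth paths representing the standard generators of `π₁(ℝⁿ / ℤⁿ)` is onto
the torus: pushing forward the signed measure `det (γᵢ' (tᵢ)) dt` gives the Haar measure, since all
Fourier coefficients agree. -/
theorem surjOn_torus_sum_paths {n : ℕ} {γ γ' : Fin n → ℝ → Fin n → ℝ}
    (hγ : ∀ i t, HasDerivAt (γ i) (γ' i t) t) (hγ' : ∀ i, Continuous (γ' i))
    (hone : ∀ i, γ i 1 = γ i 0 + Pi.single i 1) (y : UnitAddTorus (Fin n)) :
    ∃ t : Fin n → ℝ, (∀ i, t i ∈ Icc (0 : ℝ) 1) ∧ mkHom n (∑ i, γ i (t i)) = y := by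
  have hγc (i) : Continuous (γ i) := continuous_iff_continuousAt.2 fun t ↦ (hγ i t).continuousAt
  set ν : Measure (Fin n → ℝ) := Measure.pi fun _ ↦ volume.restrict (Ioc (0 : ℝ) 1) with hν
  have hνr : ν = volume.restrict (univ.pi fun _ ↦ Ioc (0 : ℝ) 1) := by
    rw [hν, volume_pi, Measure.restrict_pi_pi]
  set μ : Measure (UnitAddTorus (Fin n)) :=
    Measure.pi fun _ ↦ AddCircle.haarAddCircle (T := 1) with hμ
  have hh : Continuous fun t : Fin n → ℝ ↦ mkHom n (∑ i, γ i (t i)) :=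
    (continuous_mkHom n).comp (by fun_prop)
  have hdet : Continuous fun t : Fin n → ℝ ↦ (Matrix.of fun i j ↦ (γ' i (t i) j : ℂ)).det := by
    refine Continuous.matrix_det (continuous_matrix fun i j ↦ ?_)
    have := hγ' i
    simp only [Matrix.of_apply]
    fun_prop
  have hcpt : IsCompact (univ.pi fun _ : Fin n ↦ Icc (0 : ℝ) 1) :=
    isCompact_univ_pi fun _ ↦ isCompact_Icc
  have hsub : (univ.pi fun _ : Fin n ↦ Ioc (0 : ℝ) 1) ⊆ univ.pi fun _ ↦ Icc (0 : ℝ) 1 :=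
    pi_mono fun _ _ ↦ Ioc_subset_Icc_self
  have hw : Integrable (fun t : Fin n → ℝ ↦ (Matrix.of fun i j ↦ (γ' i (t i) j : ℂ)).det) ν := by
    rw [hνr]
    exact (hdet.continuousOn.integrableOn_compact hcpt).mono_set hsub
  obtain ⟨L, hL⟩ := exists_continuousLinearMap_integral_comp hh.measurable hw
  obtain ⟨L', hL'⟩ := exists_continuousLinearMap_integral_comp (ν := μ)
    (h := (id : UnitAddTorus (Fin n) → UnitAddTorus (Fin n))) measurable_id
    (integrable_const (1 : ℂ))
  have hLL : L = L' := by
    refine ContinuousLinearMap.ext_on (s := range mFourier) ?_ ?_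
    · rw [Submodule.dense_iff_topologicalClosure_eq_top]
      exact span_mFourier_closure_eq_top
    rintro _ ⟨m, rfl⟩
    rw [hL, hL', integral_mFourier_mul_det hγ hγ']
    simp only [mul_one, id]
    by_cases hm : m = 0
    · subst hm
      simp only [mFourier_zero, ContinuousMap.one_apply, one_mul, integral_const, probReal_univ,
        one_smul]
      convert Matrix.det_one (n := Fin n) (R := ℂ)
      ext i j
      rw [Matrix.of_apply, integral_complex_ofReal, ← intervalIntegral.integral_of_le zero_le_one,
        intervalIntegral.integral_eq_sub_of_hasDerivAt (f := fun t ↦ γ i t j)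
          (fun t _ ↦ (hasDerivAt_pi.1 (hγ i t)) j)
          (((continuous_apply j).comp (hγ' i)).intervalIntegrable _ _), hone]
      rw [Pi.add_apply, add_sub_cancel_left, Matrix.one_apply, Pi.single_apply]
      split_ifs <;> simp_all
    · rw [integral_mFourier hm, ← Matrix.exists_mulVec_eq_zero_iff]
      refine ⟨fun j ↦ (m j : ℂ), fun h ↦ hm ?_, ?_⟩
      · ext j
        simpa using congrFun h j
      · ext i
        refine integral_mFourier_path (hγ i) (hγ' i) m ?_
        rw [hone, map_add]
        convert add_zero _
        ext j
        by_cases hij : j = i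
        · subst hij; simp [mkHom]
        · simp [mkHom, hij]
  by_contra! H
  have hK := hcpt.image hh
  obtain ⟨g, hgK, hg1, hg01⟩ := exists_continuous_zero_one_of_isClosed hK.isClosed
    (isClosed_singleton (x := y)) (by
      rw [disjoint_singleton_right]
      rintro ⟨t, ht, rfl⟩
      exact H t (fun i ↦ ht i trivial) rfl)
  let gc : C(UnitAddTorus (Fin n), ℂ) := ⟨fun x ↦ (g x : ℂ), by fun_prop⟩
  have h0 : L gc = 0 := by
    rw [hL]
    refine integral_eq_zero_of_ae ?_
    rw [hνr]
    filter_upwards [ae_restrict_mem (MeasurableSet.univ_pi fun _ ↦ measurableSet_Ioc)] with t ht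
    have : g (mkHom n (∑ i, γ i (t i))) = 0 := hgK ⟨t, hsub ht, rfl⟩
    simp only [gc, ContinuousMap.coe_mk, this, Complex.ofReal_zero, zero_mul, Pi.zero_apply]
  have h1 : L' gc = ((∫ x, g x ∂μ : ℝ) : ℂ) := by
    rw [hL', ← integral_complex_ofReal]
    simp [gc]
  have hpos : 0 < ∫ x, g x ∂μ := by
    refine g.continuous.integral_pos_of_hasCompactSupport_nonneg_nonzero
      (HasCompactSupport.of_compactSpace _) (fun x ↦ (hg01 x).1) (x := y) ?_
    rw [hg1 rfl]
    exact one_ne_zero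
  rw [hLL, h1] at h0
  exact hpos.ne' (by exact_mod_cast h0)

theorem IsPreconnected.thickening {E : Type*} [NormedAddCommGroup E] [NormedSpace ℝ E]
    {C : Set E} (hC : IsPreconnected C) (ε : ℝ) : IsPreconnected (Metric.thickening ε C) := by
  rw [← add_ball_zero, ← add_image_prod]
  exact (hC.prod (convex_ball (0 : E) ε).isPreconnected).image _ continuous_add.continuousOn

theorem IsPreconnected.exists_smooth_path_thickening {E : Type*} [NormedAddCommGroup E]
    [NormedSpace ℝ E] {C : Set E} (hC : IsPreconnected C) {a b : E} (ha : a ∈ C) (hb : b ∈ C)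
    {ε : ℝ} (hε : 0 < ε) :
    ∃ γ : ℝ → E, ContDiff ℝ 1 γ ∧ γ 0 = a ∧ γ 1 = b ∧
      ∀ t ∈ Icc (0 : ℝ) 1, γ t ∈ Metric.thickening ε C := by
  have hε2 := half_pos hε
  have hsub := Metric.self_subset_thickening hε2 C
  obtain ⟨p, hp⟩ := (Metric.isOpen_thickening.isConnected_iff_isPathConnected.1
    ⟨⟨a, hsub ha⟩, hC.thickening (ε / 2)⟩).joinedIn a (hsub ha) b (hsub hb)
  obtain ⟨n, hn, hn0⟩ := (((Metric.tendsto_nhds.1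
    (bernsteinApproximation_uniform p.toContinuousMap)) (ε / 2) hε2).and
      (Filter.eventually_ne_atTop 0)).exists
  set q := bernsteinApproximation n p.toContinuousMap with hq
  let γ : ℝ → E := fun t ↦ ∑ k : Fin (n + 1),
    ((n.choose k : ℝ) * t ^ (k : ℕ) * (1 - t) ^ (n - k : ℕ)) • p.toContinuousMap (bernstein.z k)
  have hγ (t : unitInterval) : γ t = q t := by
    simp [γ, hq, bernsteinApproximation.apply, bernstein_apply]
  refine ⟨γ, by fun_prop, ?_, ?_, fun t ht ↦ ?_⟩
  · have := hγ 0
    rw [hq, bernsteinApproximation.apply_zero] at this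
    simpa using this
  · have := hγ 1
    rw [hq, bernsteinApproximation.apply_one hn0] at this
    simpa using this
  · obtain ⟨z, hz, hdz⟩ := Metric.mem_thickening_iff.1 (hp ⟨t, ht⟩)
    refine Metric.mem_thickening_iff.2 ⟨z, hz, ?_⟩
    have h1 : dist (q ⟨t, ht⟩) (p ⟨t, ht⟩) < ε / 2 :=
      (ContinuousMap.dist_apply_le_dist _).trans_lt hn
    have h2 : γ t = q ⟨t, ht⟩ := hγ ⟨t, ht⟩
    rw [h2]
    linarith [dist_triangle (q ⟨t, ht⟩) (p ⟨t, ht⟩) z]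

theorem UnitAddTorus.exists_int_of_mkHom_eq {n : ℕ} {x y : Fin n → ℝ} (h : mkHom n x = mkHom n y) :
    ∃ m : Fin n → ℤ, x = y + fun j ↦ (m j : ℝ) := by
  have (j : Fin n) : ∃ m : ℤ, x j = y j + m := by
    have hj : ((x j - y j : ℝ) : UnitAddCircle) = 0 := by
      rw [AddCircle.coe_sub, sub_eq_zero]
      exact congrFun h j
    obtain ⟨m, hm⟩ := (AddCircle.coe_eq_zero_iff (1 : ℝ)).1 hj
    exact ⟨m, by simp only [zsmul_eq_mul, mul_one] at hm; linarith⟩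
  choose m hm using this
  exact ⟨m, funext hm⟩

theorem isCompact_setOf_sum {ι E : Type*} [Fintype ι] [AddCommMonoid E] [TopologicalSpace E]
    [ContinuousAdd E] {C : ι → Set E} (hC : ∀ i, IsCompact (C i)) :
    IsCompact {x | ∃ f : ι → E, (∀ i, f i ∈ C i) ∧ ∑ i, f i = x} := by
  convert! (isCompact_univ_pi hC).image (f := fun f : ι → E ↦ ∑ i, f i) (by fun_prop) using 1
  ext x
  simp

open UnitAddTorus in
theorem mkHom_image_sum_eq_univ {n : ℕ} {C : Fin n → Set (Fin n → ℝ)}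
    (hC : ∀ i, IsCompact (C i)) (hconn : ∀ i, IsPreconnected (C i)) {a : Fin n → Fin n → ℝ}
    (ha : ∀ i, a i ∈ C i) (hb : ∀ i, a i + Pi.single i 1 ∈ C i) (y : Fin n → ℝ) :
    ∃ f : Fin n → Fin n → ℝ, (∀ i, f i ∈ C i) ∧ mkHom n (∑ i, f i) = mkHom n y := by
  set S := {x | ∃ f : Fin n → Fin n → ℝ, (∀ i, f i ∈ C i) ∧ ∑ i, f i = x}
  have hF : IsClosed (mkHom n ⁻¹' (mkHom n '' S)) :=
    ((isCompact_setOf_sum hC).image (continuous_mkHom n)).isClosed.preimage (continuous_mkHom n)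
  by_contra! H
  have hy : y ∈ (mkHom n ⁻¹' (mkHom n '' S))ᶜ := by
    rintro ⟨-, ⟨f, hf, rfl⟩, hfy⟩
    exact H f hf hfy
  obtain ⟨δ, hδ, hball⟩ := Metric.isOpen_iff.1 hF.isOpen_compl y hy
  have hε : 0 < δ / (n + 1) := by positivity
  choose γ hγ h0 h1 hγC using fun i ↦
    (hconn i).exists_smooth_path_thickening (ha i) (hb i) hε
  obtain ⟨t, ht, hty⟩ := surjOn_torus_sum_paths (γ := γ) (γ' := fun i ↦ deriv (γ i))
    (fun i t ↦ ((hγ i).differentiable one_ne_zero t).hasDerivAt)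
    (fun i ↦ (hγ i).continuous_deriv le_rfl) (fun i ↦ by rw [h0, h1]) (mkHom n y)
  choose z hz hdz using fun i ↦ Metric.mem_thickening_iff.1 (hγC i (t i) (ht i))
  have hdist : dist (∑ i, γ i (t i)) (∑ i, z i) < δ := by
    calc dist (∑ i, γ i (t i)) (∑ i, z i) ≤ ∑ i : Fin n, dist (γ i (t i)) (z i) :=
          dist_sum_sum_le _ _ _
      _ ≤ ∑ i : Fin n, δ / (n + 1) := Finset.sum_le_sum fun i _ ↦ (hdz i).le
      _ = n * (δ / (n + 1)) := by simp
      _ < (n + 1) * (δ / (n + 1)) := by gcongr; linarith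
      _ = δ := by field_simp
  refine hball (a := ∑ i, z i + (y - ∑ i, γ i (t i))) ?_ ⟨∑ i, z i, ⟨z, hz, rfl⟩, ?_⟩
  · rw [Metric.mem_ball, dist_eq_norm]
    rw [dist_comm, dist_eq_norm] at hdist
    convert hdist using 2
    abel
  · rw [map_add, map_sub, hty, sub_self, add_zero]

theorem interior_sum_nonempty_of_single {n : ℕ} {C : Fin n → Set (Fin n → ℝ)}
    (hC : ∀ i, IsCompact (C i)) (hconn : ∀ i, IsPreconnected (C i)) {a : Fin n → Fin n → ℝ}
    (ha : ∀ i, a i ∈ C i) (hb : ∀ i, a i + Pi.single i 1 ∈ C i) :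
    (interior {x | ∃ f : Fin n → Fin n → ℝ, (∀ i, f i ∈ C i) ∧ ∑ i, f i = x}).Nonempty := by
  set S := {x | ∃ f : Fin n → Fin n → ℝ, (∀ i, f i ∈ C i) ∧ ∑ i, f i = x}
  have hS : IsCompact S := isCompact_setOf_sum hC
  let e (m : Fin n → ℤ) : (Fin n → ℝ) ≃ₜ (Fin n → ℝ) := Homeomorph.addRight fun j ↦ (m j : ℝ)
  obtain ⟨m, x, hx⟩ := nonempty_interior_of_iUnion_of_closed (f := fun m ↦ e m ⁻¹' S)
    (fun m ↦ hS.isClosed.preimage (e m).continuous) (by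
      refine eq_univ_of_forall fun y ↦ mem_iUnion.2 ?_
      obtain ⟨f, hf, hfy⟩ := mkHom_image_sum_eq_univ hC hconn ha hb y
      obtain ⟨m, hm⟩ := UnitAddTorus.exists_int_of_mkHom_eq hfy
      exact ⟨m, f, hf, hm⟩)
  rw [← (e m).preimage_interior] at hx
  exact ⟨_, hx⟩

theorem interior_sum_nonempty {n : ℕ} {C : Fin n → Set (Fin n → ℝ)}
    (hC : ∀ i, IsCompact (C i)) (hconn : ∀ i, IsPreconnected (C i)) {a b : Fin n → Fin n → ℝ}
    (ha : ∀ i, a i ∈ C i) (hb : ∀ i, b i ∈ C i) (hab : LinearIndependent ℝ fun i ↦ b i - a i) :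
    (interior {x | ∃ f : Fin n → Fin n → ℝ, (∀ i, f i ∈ C i) ∧ ∑ i, f i = x}).Nonempty := by
  classical
  let B := basisOfPiSpaceOfLinearIndependent hab
  let L : (Fin n → ℝ) ≃L[ℝ] (Fin n → ℝ) := B.equivFun.toContinuousLinearEquiv
  have hL (i) : L (b i - a i) = Pi.single i 1 := by
    have : B i = b i - a i := by simp [B]
    rw [← this]
    ext j
    exact (B.equivFun_self i j).trans (by simp [Pi.single_apply, eq_comm])
  obtain ⟨x, hx⟩ := interior_sum_nonempty_of_single (C := fun i ↦ L '' C i)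
    (a := fun i ↦ L (a i)) (fun i ↦ (hC i).image L.continuous)
    (fun i ↦ (hconn i).image _ L.continuous.continuousOn) (fun i ↦ mem_image_of_mem _ (ha i))
    (fun i ↦ ⟨b i, hb i, by rw [← hL, map_sub]; abel⟩)
  have hsub : L ⁻¹' {x | ∃ f : Fin n → Fin n → ℝ, (∀ i, f i ∈ L '' C i) ∧ ∑ i, f i = x} ⊆
      {x | ∃ f : Fin n → Fin n → ℝ, (∀ i, f i ∈ C i) ∧ ∑ i, f i = x} := by
    rintro y ⟨f, hf, hfy⟩
    choose g hg hgf using hf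
    refine ⟨g, hg, L.injective ?_⟩
    rw [map_sum, ← hfy]
    exact Finset.sum_congr rfl fun i _ ↦ hgf i
  refine ⟨L.symm x, interior_mono hsub (preimage_interior_subset_interior_preimage L.continuous ?_)⟩
  simpa using hx

theorem exists_linearIndependent_of_span_eq_top {𝕜 V : Type*} [DivisionRing 𝕜] [AddCommGroup V]
    [Module 𝕜 V] {k : ℕ} (hk : k ≤ Module.finrank 𝕜 V) (W : Fin k → Set V)
    (hW : ∀ i, Submodule.span 𝕜 (W i) = ⊤) :
    ∃ w : Fin k → V, (∀ i, w i ∈ W i) ∧ LinearIndependent 𝕜 w := by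
  induction k with
  | zero => exact ⟨Fin.elim0, fun i ↦ i.elim0, linearIndependent_empty_type⟩
  | succ k ih =>
    obtain ⟨w, hw, hli⟩ := ih (by omega) (fun i ↦ W i.castSucc) (fun i ↦ hW _)
    have : ∃ x ∈ W (Fin.last k), x ∉ Submodule.span 𝕜 (range w) := by
      by_contra! H
      have htop : Submodule.span 𝕜 (range w) = ⊤ :=
        top_le_iff.1 ((hW (Fin.last k)).symm.le.trans (Submodule.span_le.2 H))
      have := finrank_range_le_card (R := 𝕜) w
      rw [Set.finrank, htop, finrank_top, Fintype.card_fin] at this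
      omega
    obtain ⟨x, hx, hxw⟩ := this
    refine ⟨Fin.snoc w x, fun i ↦ ?_, linearIndependent_finSnoc.2 ⟨hli, hxw⟩⟩
    induction i using Fin.lastCases with
    | last => simpa using hx
    | cast i => simpa using hw i

theorem interior_nonempty_of_sum_subset {n : ℕ} {V : Fin n → Set (Fin n → ℝ)}
    (hconn : ∀ i, IsPreconnected (V i)) (hbdd : ∀ i, Bornology.IsBounded (V i))
    (hne : ∀ i, (V i).Nonempty) (hspan : ∀ i, affineSpan ℝ (V i) = ⊤) {F : Set (Fin n → ℝ)}
    (hF : IsClosed F) (hVF : ∀ f : Fin n → Fin n → ℝ, (∀ i, f i ∈ V i) → ∑ i, f i ∈ F) :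
    (interior F).Nonempty := by
  choose a ha using hne
  obtain ⟨w, hw, hli⟩ := exists_linearIndependent_of_span_eq_top (𝕜 := ℝ) (V := Fin n → ℝ)
    (k := n) (by simp) (fun i ↦ (· -ᵥ a i) '' V i) (fun i ↦ by
      rw [← vectorSpan_eq_span_vsub_set_right ℝ (ha i), ← direction_affineSpan, hspan,
        AffineSubspace.direction_top])
  choose b hb hbw using hw
  have hli' : LinearIndependent ℝ fun i ↦ b i - a i := by
    rwa [show (fun i ↦ b i - a i) = w from funext hbw]
  refine (interior_sum_nonempty (C := fun i ↦ closure (V i)) (fun i ↦ (hbdd i).isCompact_closure)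
    (fun i ↦ (hconn i).closure) (fun i ↦ subset_closure (ha i)) (fun i ↦ subset_closure (hb i))
    hli').mono (interior_mono ?_)
  rintro _ ⟨f, hf, rfl⟩
  have hf' : f ∈ closure (univ.pi V) := by
    rw [closure_pi_set]
    exact fun i _ ↦ hf i
  have hcont : Continuous fun f : Fin n → Fin n → ℝ ↦ ∑ i, f i := by fun_prop
  have := map_mem_closure hcont hf' (t := F) (fun g hg ↦ hVF g fun i ↦ hg i trivial)
  rwa [hF.closure_eq] at this

theorem exists_isPreconnected_isBounded_subset {n : ℕ} {K : Set (Fin n → ℝ)}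
    [LocallyConnectedSpace K] (hnf : NowhereFlat K) {U : Set K} (hU : IsOpen U)
    (hne : U.Nonempty) :
    ∃ V : Set (Fin n → ℝ), IsPreconnected V ∧ Bornology.IsBounded V ∧ V.Nonempty ∧
      affineSpan ℝ V = ⊤ ∧ V ⊆ Subtype.val '' U := by
  obtain ⟨x, hx⟩ := hne
  obtain ⟨V, hVU, hV, hxV, hVc⟩ := locallyConnectedSpace_iff_subsets_isOpen_isConnected.1
    ‹LocallyConnectedSpace K› x (U ∩ Metric.ball x 1)
    ((hU.inter Metric.isOpen_ball).mem_nhds ⟨hx, Metric.mem_ball_self one_pos⟩)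
  refine ⟨Subtype.val '' V, hVc.isPreconnected.image _ continuous_subtype_val.continuousOn, ?_,
    ⟨x, mem_image_of_mem _ hxV⟩, ?_, image_mono (hVU.trans inter_subset_left)⟩
  · refine (Metric.isBounded_ball (x := (x : Fin n → ℝ)) (r := 1)).subset ?_
    rintro _ ⟨y, hy, rfl⟩
    exact (hVU hy).2
  · obtain ⟨O, hO, rfl⟩ := isOpen_induced_iff.1 hV
    rw [Subtype.image_preimage_coe, inter_comm]
    exact hnf O hO ⟨x, hxV, x.2⟩

theorem nFoldSum_analytic_nonmeager
    {n : ℕ} (hn : 0 < n) (K : Set (Fin n → ℝ))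
    (hloc : LocallyConnectedSpace ↥K) (hnf : NowhereFlat K)
    (A : Set (Fin n → ℝ)) (hAK : A ⊆ K)
    (hanal : MeasureTheory.AnalyticSet A)
    (hA : ¬ IsMeagre ((Subtype.val ⁻¹' A) : Set ↥K)) :
    MeasureTheory.AnalyticSet (nFoldSum A n) ∧ ¬ IsMeagre (nFoldSum A n) := by
  refine ⟨hanal.nFoldSum n, fun h ↦ ?_⟩
  rw [← inter_eq_right.2 hAK, ← Subtype.image_preimage_coe] at h
  obtain ⟨F, U, hF, hFi, hU, hUne, hUF⟩ :=
    exists_open_sum_mem_closed_of_isMeagre_nFoldSum (g := (Subtype.val : K → Fin n → ℝ)) 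
      continuous_subtype_val hA h
  choose V hconn hbdd hne hspan hVU using fun i ↦
    exists_isPreconnected_isBounded_subset hnf (hU i) (hUne i)
  refine (interior_nonempty_of_sum_subset hconn hbdd hne hspan hF fun f hf ↦ ?_).ne_empty hFi
  choose g hg hgf using fun i ↦ hVU i (hf i)
  simpa only [hgf] using hUF g hg
end

section
/- Let n ≥ 1, let K be a subset of ℝⁿ that is locally connected in its subspace topology and nowhere flat in ℝⁿ, and let A ⊆ K be an analytic set that is non-meager in the subspace K. Then the 2n-fold Minkowski sum A^{+2n} has non-empty interior in ℝⁿ. -/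
open Set MeasureTheory Topology

/-- The set of points at which `A` is everywhere of second category. -/
def nonmeagreKernel {X : Type*} [TopologicalSpace X] (A : Set X) : Set X :=
  {x | ∀ V ∈ 𝓝 x, ¬ IsMeagre (A ∩ V)}

theorem isClosed_nonmeagreKernel {X : Type*} [TopologicalSpace X] (A : Set X) :
    IsClosed (nonmeagreKernel A) := by
  rw [← isOpen_compl_iff, isOpen_iff_mem_nhds]
  intro x hx
  simp only [nonmeagreKernel, mem_compl_iff, mem_ofPred_eq, not_forall, not_not] at hx
  obtain ⟨V, hV, hm⟩ := hx
  filter_upwards [eventually_mem_nhds_iff.2 hV] with y hy h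
  exact h V hy hm

theorem nonmeagreKernel_subset_closure {X : Type*} [TopologicalSpace X] (A : Set X) :
    nonmeagreKernel A ⊆ closure A := by
  intro x hx
  rw [mem_closure_iff_nhds]
  intro V hV
  rw [inter_comm]
  exact nonempty_of_not_isMeagre (hx V hV)

theorem isMeagre_diff_nonmeagreKernel {X : Type*} [TopologicalSpace X]
    [SecondCountableTopology X] (A : Set X) : IsMeagre (A \ nonmeagreKernel A) := by
  have hc : {b ∈ TopologicalSpace.countableBasis X | IsMeagre (A ∩ b)}.Countable :=
    (TopologicalSpace.countable_countableBasis X).mono (sep_subset _ _)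
  refine (isMeagre_biUnion hc (f := fun b => A ∩ b) fun b hb => hb.2).mono ?_
  rintro x ⟨hxA, hx⟩
  simp only [nonmeagreKernel, mem_ofPred_eq, not_forall, not_not] at hx
  obtain ⟨V, hV, hm⟩ := hx
  obtain ⟨b, hb, hxb, hbV⟩ :=
    (TopologicalSpace.isBasis_countableBasis X).mem_nhds_iff.1 hV
  exact mem_biUnion (x := b) ⟨hb, hm.mono (inter_subset_inter_right _ hbV)⟩ ⟨hxA, hxb⟩

theorem isMeagre_nonmeagreKernel_iUnion_diff {X : Type*} [TopologicalSpace X]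
    [SecondCountableTopology X] {ι : Type*} [Countable ι] (A : ι → Set X) :
    IsMeagre (nonmeagreKernel (⋃ i, A i) \ ⋃ i, nonmeagreKernel (A i)) := by
  suffices h : IsNowhereDense
      (nonmeagreKernel (⋃ i, A i) \ ⋃ i, interior (nonmeagreKernel (A i))) from
    h.isMeagre.mono (sdiff_subset_sdiff_right (iUnion_mono fun i => interior_subset))
  have hcl : IsClosed (nonmeagreKernel (⋃ i, A i) \ ⋃ i, interior (nonmeagreKernel (A i))) :=
    (isClosed_nonmeagreKernel _).sdiff (isOpen_iUnion fun i => isOpen_interior)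
  rw [hcl.isNowhereDense_iff, eq_empty_iff_forall_notMem]
  intro x hx
  have hsub := interior_subset
    (s := nonmeagreKernel (⋃ i, A i) \ ⋃ i, interior (nonmeagreKernel (A i)))
  set O := interior (nonmeagreKernel (⋃ i, A i) \ ⋃ i, interior (nonmeagreKernel (A i)))
  refine (hsub hx).1 O (isOpen_interior.mem_nhds hx) ?_
  rw [iUnion_inter]
  refine isMeagre_iUnion fun i => ?_
  have hfr : IsMeagre (frontier (nonmeagreKernel (A i))) :=
    IsNowhereDense.isMeagre <| isClosed_frontier.isNowhereDense_iff.2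
      (interior_frontier (isClosed_nonmeagreKernel _))
  refine ((isMeagre_diff_nonmeagreKernel (A i)).union hfr).mono ?_
  rintro y ⟨hyA, hyO⟩
  by_cases hy : y ∈ nonmeagreKernel (A i)
  · refine Or.inr ?_
    rw [(isClosed_nonmeagreKernel _).frontier_eq]
    exact ⟨hy, fun h => (hsub hyO).2 (mem_iUnion.2 ⟨i, h⟩)⟩
  · exact Or.inl ⟨hyA, hy⟩

/-- A non-meagre continuous image of the Baire space is comeagre in some nonempty open set. -/
theorem exists_isOpen_isMeagre_diff_range {X : Type*} [TopologicalSpace X]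
    [SecondCountableTopology X] [T2Space X] {f : (ℕ → ℕ) → X} (hf : Continuous f)
    (h : ¬ IsMeagre (range f)) :
    ∃ O : Set X, IsOpen O ∧ O.Nonempty ∧ IsMeagre (O \ range f) := by
  let A : List ℕ → Set X := fun s => f '' {x | PiNat.res x s.length = s}
  have hA0 : A [] = range f := by simp [A]
  have hAs : ∀ s, A s = ⋃ k, A (k :: s) := by
    intro s
    simp only [A, ← image_iUnion]
    congr 1
    ext x
    simp [PiNat.res_succ]
  let M : Set X := ⋃ s, (nonmeagreKernel (A s) \ ⋃ k, nonmeagreKernel (A (k :: s)))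
  have hM : IsMeagre M := isMeagre_iUnion fun s => by
    conv => enter [1, 1]; rw [hAs s]
    exact isMeagre_nonmeagreKernel_iUnion_diff _
  have hsub : nonmeagreKernel (range f) \ M ⊆ range f := by
    rintro x ⟨hx, hxM⟩
    have step : ∀ s, x ∈ nonmeagreKernel (A s) → ∃ k, x ∈ nonmeagreKernel (A (k :: s)) := by
      intro s hs
      by_contra hk
      exact hxM (mem_iUnion.2 ⟨s, hs, by simpa using hk⟩)
    choose! k hk using step
    let g : ℕ → List ℕ := fun m => Nat.rec [] (fun _ s => k s :: s) m
    have hg : ∀ m, x ∈ nonmeagreKernel (A (g m)) := by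
      intro m
      induction m with
      | zero => simpa [g, hA0] using hx
      | succ m ih => exact hk _ ih
    have hres : ∀ m, PiNat.res (fun i => k (g i)) m = g m := by
      intro m
      induction m with
      | zero => rfl
      | succ m ih => rw [PiNat.res_succ, ih]
    refine ⟨fun i => k (g i), ?_⟩
    by_contra hne
    obtain ⟨U, V, hU, hV, hfU, hxV, hd⟩ := t2_separation hne
    obtain ⟨_, ⟨y, m, rfl⟩, hym, hyU⟩ :=
      (PiNat.isTopologicalBasis_cylinders (fun _ => ℕ)).mem_nhds_iff.1
      ((hU.preimage hf).mem_nhds hfU)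
    obtain ⟨z, hzV, hz⟩ := mem_closure_iff.1 (nonmeagreKernel_subset_closure _ (hg m)) V hV hxV
    obtain ⟨w, hw, rfl⟩ := hz
    refine (Set.disjoint_left.1 hd) (hyU ?_) hzV
    rw [PiNat.cylinder_eq_res] at hym ⊢
    have hlen : (g m).length = m := by rw [← hres m, PiNat.res_length]
    simp only [mem_ofPred_eq, hlen] at hw hym ⊢
    rw [hw, ← hres m, hym]
  refine ⟨interior (nonmeagreKernel (range f)), isOpen_interior, ?_, hM.mono ?_⟩
  · rw [nonempty_iff_ne_empty]
    intro he
    have := ((isClosed_nonmeagreKernel (range f)).isNowhereDense_iff.2 he).isMeagre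
    refine h (((isMeagre_diff_nonmeagreKernel (range f)).union this).mono ?_)
    intro y hy
    by_cases h' : y ∈ nonmeagreKernel (range f)
    exacts [Or.inr h', Or.inl ⟨hy, h'⟩]
  · rintro y ⟨hy, hyf⟩
    by_contra hyM
    exact hyf (hsub ⟨interior_subset hy, hyM⟩)

theorem MeasureTheory.AnalyticSet.exists_isOpen_isMeagre_diff {X : Type*} [TopologicalSpace X]
    [SecondCountableTopology X] [T2Space X] {A : Set X} (hA : MeasureTheory.AnalyticSet A)
    (h : ¬ IsMeagre A) :
    ∃ O : Set X, IsOpen O ∧ O.Nonempty ∧ IsMeagre (O \ A) := by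
  rw [MeasureTheory.AnalyticSet] at hA
  obtain rfl | ⟨f, hf, rfl⟩ := hA
  · exact absurd IsMeagre.empty h
  · exact exists_isOpen_isMeagre_diff_range hf h

theorem IsMeagre.preimage_of_forall_not_isNowhereDense_image {X Z : Type*} [TopologicalSpace X]
    [TopologicalSpace Z] {f : X → Z} (hf : Continuous f)
    (h : ∀ V : Set X, IsOpen V → V.Nonempty → ¬ IsNowhereDense (f '' V)) {s : Set Z}
    (hs : IsMeagre s) : IsMeagre (f ⁻¹' s) := by
  rw [isMeagre_iff_countable_union_isNowhereDense] at hs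
  obtain ⟨S, hS, hSc, hsS⟩ := hs
  refine (isMeagre_biUnion hSc (f := fun t => f ⁻¹' t) fun t ht => ?_).mono ?_
  · refine IsNowhereDense.isMeagre (IsNowhereDense.mono (preimage_mono subset_closure) ?_)
    rw [(isClosed_closure.preimage hf).isNowhereDense_iff, ← not_nonempty_iff_eq_empty]
    intro hne
    refine h _ isOpen_interior hne ((hS t ht).closure.mono ?_)
    exact image_subset_iff.2 interior_subset
  · intro x hx
    simpa using hsS hx

theorem IsDenseInducing.isMeagre_preimage {X Z : Type*} [TopologicalSpace X]
    [TopologicalSpace Z] {f : X → Z} (hf : IsDenseInducing f) {s : Set Z}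
    (hs : IsMeagre s) : IsMeagre (f ⁻¹' s) := by
  refine hs.preimage_of_forall_not_isNowhereDense_image hf.continuous ?_
  rintro V hV ⟨x, hx⟩ hn
  obtain ⟨W, hW, rfl⟩ := hf.isInducing.isOpen_iff.1 hV
  have h1 : W ⊆ closure (f '' (f ⁻¹' W)) := by
    rw [image_preimage_eq_inter_range]
    exact hf.dense.open_subset_closure_inter hW
  exact (eq_empty_iff_forall_notMem.1 hn) (f x) (interior_maximal h1 hW hx)

/-- Piccard's theorem for analytic sets. -/
theorem MeasureTheory.AnalyticSet.interior_add_self_nonempty {E : Type*} [AddCommGroup E]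
    [TopologicalSpace E] [IsTopologicalAddGroup E] [SecondCountableTopology E] [T2Space E]
    [BaireSpace E] {B : Set E} (hB : MeasureTheory.AnalyticSet B) (h : ¬ IsMeagre B) :
    ∃ W : Set E, IsOpen W ∧ W.Nonempty ∧ ∀ z ∈ W, ∃ b ∈ B, ∃ c ∈ B, b + c = z := by
  obtain ⟨O, hO, ⟨u, hu⟩, hm⟩ := hB.exists_isOpen_isMeagre_diff h
  refine ⟨(fun z => z - u) ⁻¹' O, hO.preimage (by fun_prop), ⟨u + u, by simpa using hu⟩, ?_⟩
  intro z hz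
  let e : E ≃ₜ E := Homeomorph.subLeft z
  have hm' : IsMeagre (e ⁻¹' (O \ B)) := hm.preimage_of_isOpenMap e.continuous e.isOpenMap
  have hne : ¬ IsMeagre (O ∩ e ⁻¹' O) :=
    not_isMeagre_of_isOpen (hO.inter (hO.preimage e.continuous)) ⟨u, hu, hz⟩
  by_contra! hcon
  refine hne ((hm.union hm').mono ?_)
  rintro b ⟨hb, hb'⟩
  by_cases hbB : b ∈ B
  · exact Or.inr ⟨hb', fun hc => hcon b hbB _ hc (by simp [e])⟩
  · exact Or.inl ⟨hb, hbB⟩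

/-- A finite family of short oriented segments, starting in a preconnected set, whose total
boundary is `b - a`. -/
theorem IsPreconnected.exists_segments {E : Type*} [SeminormedAddCommGroup E] {K : Set E}
    (hK : IsPreconnected K) {ε : ℝ} (hε : 0 < ε) {a b : E} (ha : a ∈ K) (hb : b ∈ K) :
    ∃ (ι : Type) (_ : Fintype ι) (p q : ι → E), (∀ j, p j ∈ K) ∧ (∀ j, ‖q j - p j‖ < ε) ∧
      ∀ f : E → ℂ, ∑ j, (f (q j) - f (p j)) = f b - f a := by
  refine hK.induction₂' (fun a b => ∃ (ι : Type) (_ : Fintype ι) (p q : ι → E),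
    (∀ j, p j ∈ K) ∧ (∀ j, ‖q j - p j‖ < ε) ∧
      ∀ f : E → ℂ, ∑ j, (f (q j) - f (p j)) = f b - f a) ?_ ?_ ha hb
  · intro x hx
    filter_upwards [self_mem_nhdsWithin, mem_nhdsWithin_of_mem_nhds (Metric.ball_mem_nhds x hε)]
      with y hy hyx
    rw [Metric.mem_ball, dist_eq_norm] at hyx
    exact ⟨⟨Unit, inferInstance, fun _ => x, fun _ => y, fun _ => hx, fun _ => hyx, by simp⟩,
      ⟨Unit, inferInstance, fun _ => y, fun _ => x, fun _ => hy,
        fun _ => by rwa [norm_sub_rev], by simp⟩⟩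
  · rintro x y z - - - ⟨ι, _, p, q, hp, hpq, hf⟩ ⟨ι', _, p', q', hp', hpq', hf'⟩
    refine ⟨ι ⊕ ι', inferInstance, Sum.elim p p', Sum.elim q q', ?_, ?_, fun f => ?_⟩
    · rintro (j | j)
      exacts [hp j, hp' j]
    · rintro (j | j)
      exacts [hpq j, hpq' j]
    · rw [Fintype.sum_sum_type]
      simp only [Sum.elim_inl, Sum.elim_inr, hf, hf']
      ring

/-- The covering map from `ℝⁿ` onto the torus. -/
def toUnitAddTorus {n : ℕ} (x : Fin n → ℝ) : UnitAddTorus (Fin n) := fun i => (x i : UnitAddCircle)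

theorem continuous_toUnitAddTorus {n : ℕ} : Continuous (toUnitAddTorus (n := n)) :=
  continuous_pi fun i => (AddCircle.continuous_mk' 1).comp (continuous_apply i)

theorem mFourier_toUnitAddTorus {n : ℕ} (k : Fin n → ℤ) (x : Fin n → ℝ) :
    UnitAddTorus.mFourier k (toUnitAddTorus x) =
      Complex.exp (2 * Real.pi * Complex.I * ∑ i, (k i : ℂ) * x i) := by
  simp only [UnitAddTorus.mFourier, toUnitAddTorus, ContinuousMap.coe_mk, fourier_coe_apply]
  rw [← Complex.exp_sum, Finset.mul_sum]
  congr 1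
  refine Finset.sum_congr rfl fun i _ => ?_
  push_cast
  ring

theorem mFourier_toUnitAddTorus_sum {n : ℕ} {ι : Type*} [Fintype ι] (k : Fin n → ℤ)
    (x : ι → Fin n → ℝ) :
    UnitAddTorus.mFourier k (toUnitAddTorus (∑ i, x i)) =
      ∏ i, UnitAddTorus.mFourier k (toUnitAddTorus (x i)) := by
  simp only [mFourier_toUnitAddTorus]
  rw [← Complex.exp_sum, ← Finset.mul_sum, Finset.sum_comm]
  simp [Finset.sum_apply, Finset.mul_sum]

/-- The integral of a character along a segment times the increment of its phase is the increment
of the character. -/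
theorem integral_mFourier_segment {n : ℕ} (k : Fin n → ℤ) (p q : Fin n → ℝ) :
    (2 * Real.pi * Complex.I) * ((∫ t in Ioc (0 : ℝ) 1,
        UnitAddTorus.mFourier k (toUnitAddTorus (p + t • (q - p)))) *
      ∑ l, ((q l - p l : ℝ) : ℂ) * k l) =
      UnitAddTorus.mFourier k (toUnitAddTorus q) - UnitAddTorus.mFourier k (toUnitAddTorus p) := by
  set c : ℂ := 2 * Real.pi * Complex.I with hc
  set d : ℂ := ∑ l, ((q l - p l : ℝ) : ℂ) * k l with hd
  set s : ℂ := ∑ l, (k l : ℂ) * p l with hs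
  have hE : ∀ t : ℝ, UnitAddTorus.mFourier k (toUnitAddTorus (p + t • (q - p))) =
      Complex.exp (c * (s + t * d)) := by
    intro t
    rw [mFourier_toUnitAddTorus]
    congr 2
    rw [hs, hd, Finset.mul_sum, ← Finset.sum_add_distrib]
    refine Finset.sum_congr rfl fun l _ => ?_
    simp only [Pi.add_apply, Pi.smul_apply, Pi.sub_apply, smul_eq_mul]
    push_cast
    ring
  have h0 : UnitAddTorus.mFourier k (toUnitAddTorus p) = Complex.exp (c * (s + (0 : ℝ) * d)) := by
    rw [← hE]; simp
  have h1 : UnitAddTorus.mFourier k (toUnitAddTorus q) = Complex.exp (c * (s + (1 : ℝ) * d)) := by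
    rw [← hE]; simp
  rw [h0, h1]
  simp only [hE]
  rw [← intervalIntegral.integral_of_le zero_le_one]
  have hder : ∀ t ∈ uIcc (0 : ℝ) 1, HasDerivAt (fun t : ℝ => Complex.exp (c * (s + t * d)))
      (Complex.exp (c * (s + t * d)) * (c * d)) t := by
    intro t _
    have h2 : HasDerivAt (fun t : ℝ => c * (s + (t : ℂ) * d)) (c * d) t := by
      simpa using (((Complex.ofRealCLM.hasDerivAt (x := t)).mul_const d).const_add s).const_mul c
    exact h2.cexp
  rw [← intervalIntegral.integral_eq_sub_of_hasDerivAt hder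
    (Continuous.intervalIntegrable (by fun_prop) _ _), intervalIntegral.integral_mul_const]
  ring

/-- Lebesgue measure on the unit cube. -/
noncomputable def cubeMeasure (n : ℕ) : Measure (Fin n → ℝ) :=
  Measure.pi fun _ => volume.restrict (Ioc (0 : ℝ) 1)

instance (n : ℕ) : IsProbabilityMeasure (cubeMeasure n) := by
  have : IsProbabilityMeasure (volume.restrict (Ioc (0 : ℝ) 1)) := ⟨by simp⟩
  unfold cubeMeasure
  infer_instance

/-- Integration of the pullback of a continuous function along a continuous map. -/
noncomputable def pullbackIntegral {n : ℕ} {T : Type*} [TopologicalSpace T] [CompactSpace T]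
    (g : C(Fin n → ℝ, T)) : C(T, ℂ) →L[ℂ] ℂ :=
  have hint : ∀ φ : C(T, ℂ), Integrable (fun t => φ (g t)) (cubeMeasure n) := fun φ =>
    Integrable.of_bound (φ.comp g).continuous.aestronglyMeasurable ‖φ‖
      (ae_of_all _ fun t => φ.norm_coe_le_norm _)
  LinearMap.mkContinuous
    { toFun := fun φ => ∫ t, φ (g t) ∂cubeMeasure n
      map_add' := fun φ ψ => integral_add (hint φ) (hint ψ)
      map_smul' := fun c φ => integral_smul c _ } 1 fun φ => by
    simpa using norm_integral_le_of_norm_le_const (μ := cubeMeasure n)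
      (ae_of_all _ fun t => φ.norm_coe_le_norm (g t))

/-- The sum of segments with prescribed endpoints, parametrized by the unit cube. -/
def cellMap {n : ℕ} (p q : Fin n → Fin n → ℝ) : C(Fin n → ℝ, UnitAddTorus (Fin n)) where
  toFun t := toUnitAddTorus (∑ i, (p i + t i • (q i - p i)))
  continuous_toFun := continuous_toUnitAddTorus.comp (by fun_prop)

/-- The signed count of preimages under the sum of `n` polygonal chains. -/
noncomputable def chainFunctional {n : ℕ} {ι : Fin n → Type} [∀ i, Fintype (ι i)]
    (p q : ∀ i, ι i → Fin n → ℝ) : C(UnitAddTorus (Fin n), ℂ) →L[ℂ] ℂ :=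
  ∑ r : ∀ i, ι i, (Matrix.of fun i l => ((q i (r i) l - p i (r i) l : ℝ) : ℂ)).det •
    pullbackIntegral (cellMap (fun i => p i (r i)) fun i => q i (r i))

theorem chainFunctional_mFourier {n : ℕ} {ι : Fin n → Type} [∀ i, Fintype (ι i)]
    (p q : ∀ i, ι i → Fin n → ℝ) (a b : Fin n → Fin n → ℝ)
    (hab : ∀ i, b i - a i = Pi.single i 1)
    (hpq : ∀ i, ∀ f : (Fin n → ℝ) → ℂ, ∑ j, (f (q i j) - f (p i j)) = f (b i) - f (a i))
    (k : Fin n → ℤ) :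
    chainFunctional p q (UnitAddTorus.mFourier k) = if k = 0 then 1 else 0 := by
  let c : ∀ i, ι i → ℂ := fun i j => ∫ t in Ioc (0 : ℝ) 1,
    UnitAddTorus.mFourier k (toUnitAddTorus (p i j + t • (q i j - p i j)))
  let D : ∀ i, ι i → Fin n → ℂ := fun i j l => ((q i j l - p i j l : ℝ) : ℂ)
  have h1 : chainFunctional p q (UnitAddTorus.mFourier k) =
      (Matrix.of fun i => ∑ j, c i j • D i j).det := by
    have h2 := (Matrix.detRowAlternating (n := Fin n) (R := ℂ)).toMultilinearMap.map_sum
      (fun i (j : ι i) => c i j • D i j)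
    refine Eq.trans ?_ h2.symm
    rw [chainFunctional, sum_apply]
    refine Finset.sum_congr rfl fun r _ => ?_
    rw [MultilinearMap.map_smul_univ, smul_apply, smul_eq_mul, smul_eq_mul,
      mul_comm]
    congr 1
    change ∫ t, UnitAddTorus.mFourier k (toUnitAddTorus _) ∂cubeMeasure n = _
    simp only [mFourier_toUnitAddTorus_sum]
    exact integral_fintype_prod_eq_prod (fun i (t : ℝ) =>
      UnitAddTorus.mFourier k (toUnitAddTorus (p i (r i) + t • (q i (r i) - p i (r i)))))
  rw [h1]
  split_ifs with hk
  · subst hk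
    have : (Matrix.of fun i => ∑ j, c i j • D i j) = 1 := by
      ext i l
      have h3 := hpq i (fun x => (x l : ℂ))
      have h4 := congrFun (hab i) l
      simp only [c, D, Matrix.of_apply, Finset.sum_apply, Pi.smul_apply,
        UnitAddTorus.mFourier_zero, ContinuousMap.one_apply]
      simp only [integral_const, MeasurableSet.univ, measureReal_restrict_apply, univ_inter,
        Real.volume_real_Ioc, sub_zero, zero_le_one, max_eq_left, smul_eq_mul, one_smul]
      simp only [one_mul, Complex.ofReal_sub, h3]
      rw [← Complex.ofReal_sub, ← Pi.sub_apply, h4, Matrix.one_apply, Pi.single_apply]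
      by_cases h : i = l
      · simp [h]
      · simp [h, Ne.symm h]
    rw [this, Matrix.det_one]
  · rw [← Matrix.exists_mulVec_eq_zero_iff]
    refine ⟨fun l => (k l : ℂ), fun h => hk ?_, ?_⟩
    · ext l
      simpa using congrFun h l
    · ext i
      have h3 := hpq i (fun x => UnitAddTorus.mFourier k (toUnitAddTorus x))
      have hper : UnitAddTorus.mFourier k (toUnitAddTorus (b i)) =
          UnitAddTorus.mFourier k (toUnitAddTorus (a i)) := by
        congr 1
        have : b i = a i + Pi.single i 1 := by rw [← hab i]; abel
        ext l
        simp only [this, toUnitAddTorus, Pi.add_apply, Pi.single_apply]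
        split_ifs
        · simp
        · simp
      rw [hper, sub_self] at h3
      simp only [← integral_mFourier_segment] at h3
      rw [← Finset.mul_sum] at h3
      have h5 := (mul_eq_zero.1 h3).resolve_left Complex.two_pi_I_ne_zero
      rw [Pi.zero_apply, ← h5]
      simp only [Matrix.mulVec, dotProduct, Matrix.of_apply, Finset.sum_apply, Pi.smul_apply,
        smul_eq_mul, c, D, Finset.sum_mul, Finset.mul_sum]
      rw [Finset.sum_comm]
      simp only [mul_assoc]

theorem chainFunctional_eq_integral {n : ℕ} {ι : Fin n → Type} [∀ i, Fintype (ι i)]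
    (p q : ∀ i, ι i → Fin n → ℝ) (a b : Fin n → Fin n → ℝ)
    (hab : ∀ i, b i - a i = Pi.single i 1)
    (hpq : ∀ i, ∀ f : (Fin n → ℝ) → ℂ, ∑ j, (f (q i j) - f (p i j)) = f (b i) - f (a i))
    (φ : C(UnitAddTorus (Fin n), ℂ)) :
    chainFunctional p q φ = ∫ x, φ x ∂(Measure.pi fun _ => AddCircle.haarAddCircle) := by
  have h1 : chainFunctional p q = chainFunctional (ι := fun _ : Fin n => Unit)
      (fun _ _ => 0) (fun i _ => Pi.single i 1) := by
    refine ContinuousLinearMap.ext_on (s := range UnitAddTorus.mFourier) ?_ ?_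
    · rw [Submodule.dense_iff_topologicalClosure_eq_top]
      exact UnitAddTorus.span_mFourier_closure_eq_top
    · rintro _ ⟨k, rfl⟩
      rw [chainFunctional_mFourier p q a b hab hpq, chainFunctional_mFourier _ _ 0
        (fun i => Pi.single i 1) (by simp) (by simp)]
  rw [h1]
  have h2 : (Matrix.of fun i l => (((Pi.single i 1 : Fin n → ℝ) l - (0 : Fin n → ℝ) l : ℝ) : ℂ))
      = 1 := by
    ext i l
    by_cases h : i = l
    · subst h
      rw [Matrix.one_apply_eq]
      simp
    · rw [Matrix.one_apply_ne h]
      simp [Ne.symm h]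
  simp only [chainFunctional, Fintype.sum_unique, h2, Matrix.det_one, one_smul]
  refine Eq.trans ?_ (UnitAddTorus.integral_preimage (fun x => φ x) (0 : Fin n → ℝ)).symm
  have h3 : {x : Fin n → ℝ | ∀ i, x i ∈ Ioc ((0 : Fin n → ℝ) i) ((0 : Fin n → ℝ) i + 1)} =
      univ.pi fun _ => Ioc (0 : ℝ) 1 := by
    ext; simp
  rw [h3, volume_pi, Measure.restrict_pi_pi]
  change ∫ t, φ (toUnitAddTorus _) ∂cubeMeasure n = _
  refine integral_congr_ae (ae_of_all _ fun t => ?_)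
  simp only
  congr 2
  ext l
  simp [Finset.sum_apply, Pi.single_apply]

theorem dist_toUnitAddTorus_le {n : ℕ} (x y : Fin n → ℝ) :
    dist (toUnitAddTorus x) (toUnitAddTorus y) ≤ dist x y := by
  rw [dist_pi_le_iff dist_nonneg]
  intro i
  refine le_trans ?_ (dist_le_pi_dist x y i)
  rw [dist_eq_norm, dist_eq_norm]
  exact QuotientAddGroup.norm_mk_le_norm (m := x i - y i)

theorem toUnitAddTorus_sum_surjective {n : ℕ} {K : Fin n → Set (Fin n → ℝ)}
    (hK : ∀ i, IsCompact (K i)) (hK' : ∀ i, IsPreconnected (K i)) {a b : Fin n → Fin n → ℝ}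
    (ha : ∀ i, a i ∈ K i) (hb : ∀ i, b i ∈ K i) (hab : ∀ i, b i - a i = Pi.single i 1)
    (y : UnitAddTorus (Fin n)) : ∃ x ∈ univ.pi K, toUnitAddTorus (∑ i, x i) = y := by
  by_contra! hy
  have hS : IsCompact ((fun x : Fin n → Fin n → ℝ => toUnitAddTorus (∑ i, x i)) '' univ.pi K) :=
    (isCompact_univ_pi hK).image (continuous_toUnitAddTorus.comp (by fun_prop))
  obtain ⟨δ, hδ, hball⟩ := Metric.isOpen_iff.1 hS.isClosed.isOpen_compl y (by
    rintro ⟨x, hx, hxy⟩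
    exact hy x hx hxy)
  let ε := δ / (2 * (n + 1))
  have hε : 0 < ε := by positivity
  have hnε : n * ε ≤ δ / 2 := by
    simp only [ε]
    rw [mul_div_assoc', div_le_div_iff₀ (by positivity) two_pos]
    nlinarith
  choose ι hι p q hp hpq hf using fun i => (hK' i).exists_segments hε (ha i) (hb i)
  let ψ : C(UnitAddTorus (Fin n), ℝ) := ⟨fun x => max 0 (δ / 2 - dist x y), by fun_prop⟩
  let φ : C(UnitAddTorus (Fin n), ℂ) := ⟨fun x => (ψ x : ℂ), by fun_prop⟩
  have h1 := chainFunctional_eq_integral p q a b hab hf φ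
  have h2 : chainFunctional p q φ = 0 := by
    rw [chainFunctional, sum_apply]
    refine Finset.sum_eq_zero fun r _ => ?_
    rw [smul_apply]
    refine smul_eq_zero_of_right _ ?_
    change ∫ t, φ _ ∂cubeMeasure n = 0
    have hcube : cubeMeasure n = volume.restrict (univ.pi fun _ => Ioc (0 : ℝ) 1) := by
      rw [volume_pi, Measure.restrict_pi_pi, cubeMeasure]
    rw [hcube]
    refine setIntegral_eq_zero_of_forall_eq_zero fun t ht => ?_
    set z := cellMap (fun i => p i (r i)) (fun i => q i (r i)) t with hz
    have hx : toUnitAddTorus (∑ i, p i (r i)) ∉ Metric.ball y δ := fun h =>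
      hball h ⟨fun i => p i (r i), fun i _ => hp i _, rfl⟩
    have hd : dist z (toUnitAddTorus (∑ i, p i (r i))) ≤ δ / 2 := by
      refine (dist_toUnitAddTorus_le _ _).trans (le_trans ?_ hnε)
      rw [dist_eq_norm, ← Finset.sum_sub_distrib]
      refine (norm_sum_le _ _).trans ?_
      refine (Finset.sum_le_card_nsmul _ _ ε fun i _ => ?_).trans (by simp)
      have hti : t i ∈ Ioc (0 : ℝ) 1 := ht i (mem_univ i)
      rw [add_sub_cancel_left, norm_smul, Real.norm_of_nonneg hti.1.le]
      exact (mul_le_of_le_one_left (norm_nonneg _) hti.2).trans (hpq i _).le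
    have : δ / 2 ≤ dist z y := by
      rw [Metric.mem_ball, not_lt] at hx
      have := dist_triangle_left (toUnitAddTorus (∑ i, p i (r i))) y z
      linarith
    simp [φ, ψ, this]
  have h3 : 0 < ∫ x, ψ x ∂(Measure.pi fun _ => AddCircle.haarAddCircle) := by
    refine ψ.continuous.integral_pos_of_hasCompactSupport_nonneg_nonzero (x := y)
      (HasCompactSupport.of_compactSpace _) (fun x => le_max_left _ _) ?_
    simpa [ψ] using hδ
  rw [h2] at h1
  have h4 : ∫ x, φ x ∂(Measure.pi fun _ => AddCircle.haarAddCircle) =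
      ((∫ x, ψ x ∂(Measure.pi fun _ => AddCircle.haarAddCircle) : ℝ) : ℂ) := integral_ofReal
  rw [h4] at h1
  exact h3.ne (by exact_mod_cast h1)

theorem exists_linearIndependent_mem_of_span_eq_top {𝕜 V : Type*} [Field 𝕜] [AddCommGroup V]
    [Module 𝕜 V] [FiniteDimensional 𝕜 V] :
    ∀ m ≤ Module.finrank 𝕜 V, ∀ S : Fin m → Set V, (∀ i, Submodule.span 𝕜 (S i) = ⊤) →
      ∃ v : Fin m → V, (∀ i, v i ∈ S i) ∧ LinearIndependent 𝕜 v
  | 0, _, _, _ => ⟨Fin.elim0, fun i => i.elim0, linearIndependent_empty_type⟩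
  | m + 1, hm, S, hS => by
    obtain ⟨v, hv, hli⟩ := exists_linearIndependent_mem_of_span_eq_top m (by omega)
      (fun i => S i.castSucc) fun i => hS _
    have hx : ∃ x ∈ S (Fin.last m), x ∉ Submodule.span 𝕜 (range v) := by
      by_contra! h
      have h1 : Submodule.span 𝕜 (range v) = ⊤ := by
        rw [eq_top_iff, ← hS (Fin.last m)]
        exact Submodule.span_le.2 h
      have h2 := finrank_span_eq_card hli
      rw [h1, finrank_top, Fintype.card_fin] at h2
      omega
    obtain ⟨x, hxS, hx⟩ := hx
    refine ⟨Fin.snoc v x, fun i => ?_, linearIndependent_finSnoc.2 ⟨hli, hx⟩⟩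
    refine Fin.lastCases ?_ (fun j => ?_) i
    · simpa using hxS
    · simpa using hv j

theorem interior_sum_nonempty_of_sub_eq_single {n : ℕ} {K : Fin n → Set (Fin n → ℝ)}
    (hK : ∀ i, IsCompact (K i)) (hK' : ∀ i, IsPreconnected (K i)) {a b : Fin n → Fin n → ℝ}
    (ha : ∀ i, a i ∈ K i) (hb : ∀ i, b i ∈ K i) (hab : ∀ i, b i - a i = Pi.single i 1) :
    (interior ((fun x : Fin n → Fin n → ℝ => ∑ i, x i) '' univ.pi K)).Nonempty := by
  set S := (fun x : Fin n → Fin n → ℝ => ∑ i, x i) '' univ.pi K with hSdef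
  have hS : IsClosed S := ((isCompact_univ_pi hK).image (by fun_prop)).isClosed
  let e : (Fin n → ℤ) → (Fin n → ℝ) ≃ₜ (Fin n → ℝ) := fun z =>
    Homeomorph.addRight (fun i => (z i : ℝ))
  obtain ⟨z, hz⟩ := nonempty_interior_of_iUnion_of_closed (f := fun z => e z ⁻¹' S)
    (fun z => hS.preimage (e z).continuous) (by
      refine eq_univ_of_forall fun y => ?_
      obtain ⟨x, hx, hxy⟩ := toUnitAddTorus_sum_surjective hK hK' ha hb hab (toUnitAddTorus y)
      have h : ∀ i, ∃ m : ℤ, y i + m = (∑ j, x j) i := by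
        intro i
        have h1 : (((∑ j, x j) i : ℝ) : UnitAddCircle) = (y i : ℝ) := congrFun hxy i
        obtain ⟨m, hm⟩ := AddSubgroup.mem_zmultiples_iff.1 (QuotientAddGroup.eq_iff_sub_mem.1 h1)
        exact ⟨m, by rw [zsmul_one] at hm; linarith⟩
      choose m hm using h
      exact mem_iUnion.2 ⟨m, x, hx, (funext hm).symm⟩)
  rw [← (e z).preimage_interior] at hz
  obtain ⟨y, hy⟩ := hz
  exact ⟨_, hy⟩

theorem interior_sum_nonempty_of_linearIndependent {n : ℕ} {K : Fin n → Set (Fin n → ℝ)}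
    (hK : ∀ i, IsCompact (K i)) (hK' : ∀ i, IsPreconnected (K i)) {a b : Fin n → Fin n → ℝ}
    (ha : ∀ i, a i ∈ K i) (hb : ∀ i, b i ∈ K i)
    (hab : LinearIndependent ℝ fun i => b i - a i) :
    (interior ((fun x : Fin n → Fin n → ℝ => ∑ i, x i) '' univ.pi K)).Nonempty := by
  let B : Module.Basis (Fin n) ℝ (Fin n → ℝ) :=
    Module.Basis.mk hab (hab.span_eq_top_of_card_eq_finrank' (by simp)).ge
  let e : (Fin n → ℝ) ≃L[ℝ] (Fin n → ℝ) := B.equivFun.toContinuousLinearEquiv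
  have hB : ∀ i, e (b i - a i) = Pi.single i 1 := by
    intro i
    have h1 : B i = b i - a i := by simp [B]
    rw [← h1]
    ext j
    simp [e, Pi.single_apply, eq_comm]
  have h := interior_sum_nonempty_of_sub_eq_single (K := fun i => e '' K i)
    (fun i => (hK i).image e.continuous)
    (fun i => (hK' i).image _ e.continuous.continuousOn) (a := fun i => e (a i))
    (b := fun i => e (b i)) (fun i => mem_image_of_mem _ (ha i))
    (fun i => mem_image_of_mem _ (hb i)) (fun i => by rw [← map_sub, hB])
  obtain ⟨y, hy⟩ := h
  refine ⟨e.symm y, mem_interior.2 ⟨_, ?_, isOpen_interior.preimage e.continuous,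
    mem_preimage.2 ((e.apply_symm_apply y).symm ▸ hy)⟩⟩
  intro w hw
  obtain ⟨x, hx, hxw⟩ := interior_subset hw
  refine ⟨fun i => e.symm (x i), fun i _ => ?_, ?_⟩
  · obtain ⟨u, hu, hux⟩ := hx i (mem_univ i)
    simpa [← hux] using hu
  · apply e.injective
    simpa using hxw

theorem interior_sum_nonempty_of_affineSpan_eq_top {n : ℕ} {K : Fin n → Set (Fin n → ℝ)}
    (hK : ∀ i, IsCompact (K i)) (hK' : ∀ i, IsPreconnected (K i))
    (hne : ∀ i, (K i).Nonempty) (hspan : ∀ i, affineSpan ℝ (K i) = ⊤) :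
    (interior ((fun x : Fin n → Fin n → ℝ => ∑ i, x i) '' univ.pi K)).Nonempty := by
  choose a ha using hne
  obtain ⟨v, hv, hli⟩ := exists_linearIndependent_mem_of_span_eq_top (𝕜 := ℝ) n (by simp)
    (fun i => (fun x => x -ᵥ a i) '' K i) fun i => by
      rw [← vectorSpan_eq_span_vsub_set_right ℝ (ha i), ← direction_affineSpan, hspan,
        AffineSubspace.direction_top]
  choose b hb hbv using hv
  refine interior_sum_nonempty_of_linearIndependent hK hK' ha hb ?_
  rw [show (fun i => b i - a i) = v from funext hbv]
  exact hli

/-- In a locally connected nowhere flat set `K`, relatively open subsets of the closure of `K`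
contain compact connected sets that are not flat. -/
theorem NowhereFlat.exists_isCompact_isPreconnected {n : ℕ} {K : Set (Fin n → ℝ)}
    [LocallyConnectedSpace K] (hK : NowhereFlat K) {V : Set (Fin n → ℝ)} (hV : IsOpen V)
    (hVK : (V ∩ closure K).Nonempty) :
    ∃ C ⊆ V ∩ closure K, IsCompact C ∧ IsPreconnected C ∧ C.Nonempty ∧ affineSpan ℝ C = ⊤ := by
  obtain ⟨y, hyV, hyK⟩ := hVK
  obtain ⟨x, hxV, hxK⟩ := mem_closure_iff.1 hyK V hV hyV
  obtain ⟨r, hr, hrV⟩ := Metric.nhds_basis_closedBall.mem_iff.1 (hV.mem_nhds hxV)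
  have hball : ((↑) : K → Fin n → ℝ) ⁻¹' Metric.ball x r ∈ nhds (⟨x, hxK⟩ : K) :=
    (Metric.isOpen_ball.preimage continuous_subtype_val).mem_nhds (Metric.mem_ball_self hr)
  obtain ⟨U, ⟨hUo, hxU, hUc⟩, hUball⟩ :=
    (LocallyConnectedSpace.open_connected_basis (⟨x, hxK⟩ : K)).mem_iff.1 hball
  obtain ⟨W, hW, rfl⟩ := isOpen_induced_iff.1 hUo
  have himg : ((↑) : K → Fin n → ℝ) '' (((↑) : K → Fin n → ℝ) ⁻¹' W) = W ∩ K := by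
    rw [Subtype.image_preimage_coe, inter_comm]
  have hsub : closure (W ∩ K) ⊆ Metric.closedBall x r := by
    refine closure_minimal ?_ Metric.isClosed_closedBall
    rintro w ⟨hw, hwK⟩
    exact Metric.ball_subset_closedBall (hUball (show (⟨w, hwK⟩ : K) ∈ _ from hw))
  have hne : (W ∩ K).Nonempty := ⟨x, hxU, hxK⟩
  refine ⟨closure (W ∩ K), subset_inter (hsub.trans hrV) (closure_mono inter_subset_right),
    (isCompact_closedBall x r).of_isClosed_subset isClosed_closure hsub, ?_, hne.closure, ?_⟩
  · rw [← himg]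
    exact (hUc.isPreconnected.image _ continuous_subtype_val.continuousOn).closure
  · rw [eq_top_iff, ← hK W hW hne]
    exact affineSpan_mono ℝ subset_closure

theorem NowhereFlat.not_isNowhereDense_image_sum {n : ℕ} {K : Set (Fin n → ℝ)}
    [LocallyConnectedSpace K] (hK : NowhereFlat K) {V : Set (Fin n → closure K)} (hV : IsOpen V)
    (hne : V.Nonempty) :
    ¬ IsNowhereDense ((fun x : Fin n → closure K => ∑ i, (x i : Fin n → ℝ)) '' V) := by
  obtain ⟨v, hv⟩ := hne
  obtain ⟨U, hU, hUV⟩ := isOpen_pi_iff'.1 hV v hv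
  choose W hW hWU using fun i => isOpen_induced_iff.1 (hU i).1
  choose C hCW hCc hCp hCne hCs using fun i => hK.exists_isCompact_isPreconnected (hW i)
    ⟨v i, by
      have := (hU i).2
      rw [← hWU i] at this
      exact this, (v i).2⟩
  have h := interior_sum_nonempty_of_affineSpan_eq_top hCc hCp hCne hCs
  intro hnd
  refine h.ne_empty (subset_eq_empty (interior_mono ?_) hnd)
  refine Subset.trans ?_ subset_closure
  rintro _ ⟨x, hx, rfl⟩
  refine ⟨fun i => ⟨x i, (hCW i (hx i (mem_univ i))).2⟩, hUV fun i _ => ?_, rfl⟩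
  rw [← hWU i]
  exact (hCW i (hx i (mem_univ i))).1

theorem analyticSet_nFoldSum {E : Type*} [AddCommMonoid E] [TopologicalSpace E] [ContinuousAdd E]
    {A : Set E} (hA : AnalyticSet A) (n : ℕ) : AnalyticSet (nFoldSum A n) := by
  obtain ⟨β, _, _, f, hf, rfl⟩ := analyticSet_iff_exists_polishSpace_range.1 hA
  refine analyticSet_iff_exists_polishSpace_range.2
    ⟨Fin n → β, inferInstance, inferInstance, fun x => ∑ i, f (x i), by fun_prop, ?_⟩
  ext y
  constructor
  · rintro ⟨x, rfl⟩
    exact ⟨fun i => f (x i), fun i => mem_range_self _, rfl⟩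
  · rintro ⟨g, hg, rfl⟩
    choose x hx using hg
    exact ⟨x, by simp [hx]⟩

theorem add_mem_nFoldSum {E : Type*} [AddCommMonoid E] {A : Set E} {m n : ℕ} {x y : E}
    (hx : x ∈ nFoldSum A m) (hy : y ∈ nFoldSum A n) : x + y ∈ nFoldSum A (m + n) := by
  obtain ⟨f, hf, rfl⟩ := hx
  obtain ⟨g, hg, rfl⟩ := hy
  refine ⟨Fin.append f g, fun i => ?_, by simp [Fin.sum_univ_add]⟩
  refine Fin.addCases (fun j => ?_) (fun j => ?_) i
  · simpa using hf j
  · simpa using hg j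

theorem NowhereFlat.not_isMeagre_nFoldSum {n : ℕ} {K : Set (Fin n → ℝ)}
    [LocallyConnectedSpace K] (hK : NowhereFlat K) {A : Set (Fin n → ℝ)} (hanal : AnalyticSet A)
    (hA : ¬ IsMeagre ((↑) ⁻¹' A : Set K)) : ¬ IsMeagre (nFoldSum A n) := by
  have : PolishSpace (closure K) := isClosed_closure.polishSpace
  have hAY : ¬ IsMeagre ((↑) ⁻¹' A : Set (closure K)) := by
    have hd : IsDenseInducing (inclusion (subset_closure (s := K))) := by
      refine ⟨(Topology.IsEmbedding.inclusion subset_closure).isInducing, ?_⟩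
      rw [denseRange_inclusion_iff]
    exact fun h => hA (hd.isMeagre_preimage h)
  obtain ⟨O, hO, ⟨o, ho⟩, hm⟩ :=
    (hanal.preimage (continuous_subtype_val (p := (· ∈ closure K)))).exists_isOpen_isMeagre_diff hAY
  intro hsum
  have h1 := hsum.preimage_of_forall_not_isNowhereDense_image
    (f := fun x : Fin n → closure K => ∑ i, (x i : Fin n → ℝ)) (by fun_prop)
    fun V hV hne => hK.not_isNowhereDense_image_sum hV hne
  have h2 : IsMeagre (⋃ i, (fun x : Fin n → closure K => x i) ⁻¹'
      (O \ ((↑) ⁻¹' A : Set (closure K)))) :=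
    isMeagre_iUnion fun i => hm.preimage_of_isOpenMap (continuous_apply i) (isOpenMap_eval i)
  refine not_isMeagre_of_isOpen (isOpen_set_pi finite_univ fun (_ : Fin n) _ => hO)
    ⟨fun _ => o, fun _ _ => ho⟩ ((h1.union h2).mono fun x hx => ?_)
  by_cases h : ∀ i, (x i : Fin n → ℝ) ∈ A
  · exact Or.inl ⟨fun i => x i, h, rfl⟩
  · push Not at h
    obtain ⟨i, hi⟩ := h
    exact Or.inr (mem_iUnion.2 ⟨i, hx i (mem_univ i), hi⟩)

theorem nFoldSum_twice_interior_nonempty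
    {n : ℕ} (hn : 0 < n) (K : Set (Fin n → ℝ))
    (hloc : LocallyConnectedSpace ↥K) (hnf : NowhereFlat K)
    (A : Set (Fin n → ℝ)) (hAK : A ⊆ K)
    (hanal : MeasureTheory.AnalyticSet A)
    (hA : ¬ IsMeagre ((Subtype.val ⁻¹' A) : Set ↥K)) :
    (interior (nFoldSum A (2 * n))).Nonempty := by
  obtain ⟨W, hW, ⟨w, hw⟩, hsub⟩ :=
    (analyticSet_nFoldSum hanal n).interior_add_self_nonempty (hnf.not_isMeagre_nFoldSum hanal hA)
  refine ⟨w, interior_maximal (fun z hz => ?_) hW hw⟩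
  obtain ⟨b, hb, c, hc, rfl⟩ := hsub z hz
  rw [two_mul]
  exact add_mem_nFoldSum hb hc
end
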